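/- arXiv:2011.11654 — 5 statements merged into one kernel-verified Lean document; each statement's English description precedes it below -/
import Mathlib

section
/- Error bound for the conjugate DP operator (Theorem 3.1(iii)): Let d ≥ 1. Let X ⊆ ℝ^d be nonempty compact with ‖x‖ ≤ τ for all x ∈ X, X_N ⊆ X finite nonempty, U ⊆ ℝ^c nonempty compact with ‖u‖ ≤ η for all u ∈ U, A′ : ℝ^d → ℝ^d and B′ : ℝ^c → ℝ^d linear, g_u : ℝ^c → ℝ and g_x : ℝ^d → ℝ continuous, and J : ℝ^d → ℝ be L_J-Lipschitz on X. Assume (feasibility) that for every u ∈ U the image {A′x̃ + B′u : x̃ ∈ X} equals X. Let S̃ ⊆ ℝ^d be nonempty compact with ‖s‖ ≤ √d · L_J for all s ∈ S̃, let S̄_K ⊆ S̃ be finite nonempty, and set S := {A′ᵀ s : s ∈ S̃}. Let J^* be the discrete LFT of J over X_N, g_u⋆ the LFT of g_u over U, h(s) := g_u⋆(−B′ᵀ s) + J^*(s), DP_conj(x) := g_x(x) + max_{s ∈ S̄_K}(⟪A′x, s⟫ − h(s)), DP_shift[J](x̃) := min_{u ∈ U}(g_u(u) + J(A′x̃ +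 B′u)), and DP_shift[J]⋆⋆(x) := sup_{σ ∈ S}(⟪x, σ⟫ − sup_{x̃ ∈ X}(⟪σ, x̃⟫ − DP_shift[J](x̃))). Then for every x ∈ X_N: |DP_conj(x) − DP_shift[J]⋆⋆(x) − g_x(x)| ≤ E₁ + E₂, where E₁ := (1 + √d) · L_J · d_H(X, X_N) and E₂ := (‖A′‖·τ + τ + ‖B′‖·η) · d_H(S̃, S̄_K) (the paper's E₂ = (1+√d)(τ+η)·d_H(S, S_K) with explicit operator-norm constants), and ‖A′‖, ‖B′‖ denote operator norms. -/
open scoped RealInnerProductSpace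

/-- One-sided Hausdorff distance `d_H(X, Y) = sup_{x ∈ X} inf_{y ∈ Y} ‖x − y‖`. -/
noncomputable def dH {E : Type*} [PseudoMetricSpace E] (X Y : Set E) : ℝ :=
  sSup ((fun x => Metric.infDist x Y) '' X)

/-- The image of a compact set under a continuous perturbation of a linear form is bounded. -/
lemma bddAbove_inner_sub_image {E : Type*} [NormedAddCommGroup E] [InnerProductSpace ℝ E]
    {X : Set E} (hX : IsCompact X) {f : E → ℝ} (hf : ContinuousOn f X) (s : E) :
    BddAbove ((fun x => ⟪s, x⟫ - f x) '' X) :=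
  hX.bddAbove_image ((by fun_prop : Continuous fun x => ⟪s, x⟫).continuousOn.sub hf)

lemma exists_dist_le_dH {E : Type*} [PseudoMetricSpace E] {X : Set E} (hX : IsCompact X)
    {Y : Finset E} (hY : Y.Nonempty) {x : E} (hx : x ∈ X) :
    ∃ y ∈ Y, dist x y ≤ dH X (Y : Set E) := by
  obtain ⟨y, hy, hxy⟩ :=
    Y.finite_toSet.isCompact.exists_infDist_eq_dist (Finset.coe_nonempty.2 hY) x
  refine ⟨y, hy, hxy ▸ ?_⟩
  exact le_csSup (hX.bddAbove_image (Metric.continuous_infDist_pt _).continuousOn)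
    (Set.mem_image_of_mem _ hx)

lemma dH_nonneg {E : Type*} [PseudoMetricSpace E] (X Y : Set E) : 0 ≤ dH X Y :=
  Real.sSup_nonneg (by rintro _ ⟨x, -, rfl⟩; exact Metric.infDist_nonneg)

/-- The Legendre–Fenchel transform over a set bounded by `τ` is `τ`-Lipschitz. -/
lemma sSup_inner_sub_le_add {E : Type*} [NormedAddCommGroup E] [InnerProductSpace ℝ E]
    {X : Set E} (hne : X.Nonempty) {f : E → ℝ} {τ : ℝ} (hτ : ∀ x ∈ X, ‖x‖ ≤ τ) (s t : E)
    (hb : BddAbove ((fun x => ⟪t, x⟫ - f x) '' X)) :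
    sSup ((fun x => ⟪s, x⟫ - f x) '' X) ≤ sSup ((fun x => ⟪t, x⟫ - f x) '' X) + τ * ‖s - t‖ := by
  refine csSup_le (hne.image _) ?_
  rintro _ ⟨x, hx, rfl⟩
  have h1 : ⟪t, x⟫ - f x ≤ sSup ((fun x => ⟪t, x⟫ - f x) '' X) :=
    le_csSup hb (Set.mem_image_of_mem _ hx)
  have h2 : ⟪s, x⟫ - ⟪t, x⟫ ≤ τ * ‖s - t‖ := by
    rw [← inner_sub_left, mul_comm]
    exact (real_inner_le_norm _ _).trans (by gcongr; exact hτ x hx)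
  dsimp only
  linarith

/-- Discretizing the primal domain decreases the Legendre–Fenchel transform of an `L`-Lipschitz
function by at most `(‖s‖ + L)` times the one-sided Hausdorff distance. -/
lemma sSup_inner_sub_le_sup'_add {E : Type*} [NormedAddCommGroup E] [InnerProductSpace ℝ E]
    {X : Set E} (hne : X.Nonempty) (hX : IsCompact X) {Y : Finset E} (hY : Y.Nonempty)
    (hYX : (Y : Set E) ⊆ X) {f : E → ℝ} {L : ℝ} (hL : 0 ≤ L)
    (hf : ∀ x ∈ X, ∀ y ∈ X, |f x - f y| ≤ L * ‖x - y‖) (s : E) :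
    sSup ((fun x => ⟪s, x⟫ - f x) '' X) ≤
      (Y.sup' hY fun y => ⟪s, y⟫ - f y) + (‖s‖ + L) * dH X (Y : Set E) := by
  refine csSup_le (hne.image _) ?_
  rintro _ ⟨x, hx, rfl⟩
  obtain ⟨y, hy, hxy⟩ := exists_dist_le_dH hX hY hx
  have h1 : ⟪s, y⟫ - f y ≤ Y.sup' hY fun y => ⟪s, y⟫ - f y :=
    Finset.le_sup' (fun y => ⟪s, y⟫ - f y) hy
  have h2 : ⟪s, x⟫ - ⟪s, y⟫ ≤ ‖s‖ * ‖x - y‖ := by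
    rw [← inner_sub_right]
    exact real_inner_le_norm _ _
  have h3 := (abs_le.1 (hf x hx y (hYX hy))).1
  have h4 : (‖s‖ + L) * ‖x - y‖ ≤ (‖s‖ + L) * dH X (Y : Set E) := by
    rw [← dist_eq_norm]
    gcongr
  dsimp only
  linarith

/-- The Legendre–Fenchel transform of a Bellman operator with linear dynamics splits into the
transforms of the stage cost and of the value function. -/
lemma sSup_inner_adjoint_sub_sInf {E F : Type*} [NormedAddCommGroup E] [InnerProductSpace ℝ E]
    [CompleteSpace E] [NormedAddCommGroup F] [InnerProductSpace ℝ F] [CompleteSpace F]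
    {X : Set E} (hXne : X.Nonempty) (hX : IsCompact X)
    {U : Set F} (hUne : U.Nonempty) (hU : IsCompact U) (A : E →L[ℝ] E) (B : F →L[ℝ] E)
    {g : F → ℝ} (hg : ContinuousOn g U) {J : E → ℝ} (hJ : ContinuousOn J X)
    (hfeas : ∀ u ∈ U, (fun x => A x + B u) '' X = X) (s : E) :
    sSup ((fun x => ⟪(ContinuousLinearMap.adjoint A) s, x⟫ -
        sInf ((fun u => g u + J (A x + B u)) '' U)) '' X) =
      sSup ((fun u => ⟪-(ContinuousLinearMap.adjoint B) s, u⟫ - g u) '' U) +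
        sSup ((fun x => ⟪s, x⟫ - J x) '' X) := by
  have hmem : ∀ x ∈ X, ∀ u ∈ U, A x + B u ∈ X := fun x hx u hu =>
    hfeas u hu ▸ Set.mem_image_of_mem (fun x => A x + B u) hx
  refine IsLUB.csSup_eq ⟨?_, ?_⟩ (hXne.image _)
  · rintro _ ⟨x, hx, rfl⟩
    rw [sub_le_comm]
    refine le_csInf (hUne.image _) ?_
    rintro _ ⟨u, hu, rfl⟩
    have h1 := le_csSup (bddAbove_inner_sub_image hU hg (-(ContinuousLinearMap.adjoint B) s))
      (Set.mem_image_of_mem _ hu)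
    have h2 := le_csSup (bddAbove_inner_sub_image hX hJ s)
      (Set.mem_image_of_mem _ (hmem x hx u hu))
    simp only [inner_neg_left, inner_add_right, ContinuousLinearMap.adjoint_inner_left] at h1 h2 ⊢
    linarith
  · intro M hM
    rw [← le_sub_iff_add_le]
    refine csSup_le (hUne.image _) ?_
    rintro _ ⟨u, hu, rfl⟩
    rw [le_sub_comm]
    refine csSup_le (hXne.image _) ?_
    rintro _ ⟨y, hy, rfl⟩
    obtain ⟨x, hx, rfl⟩ := (hfeas u hu).symm ▸ hy
    have hbdd : BddBelow ((fun u => g u + J (A x + B u)) '' U) :=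
      hU.bddBelow_image (hg.add (hJ.comp (by fun_prop) (hmem x hx)))
    have h1 := csInf_le hbdd (Set.mem_image_of_mem _ hu)
    have h2 := hM (Set.mem_image_of_mem _ hx)
    simp only [inner_neg_left, inner_add_right, ContinuousLinearMap.adjoint_inner_left] at h1 h2 ⊢
    linarith

/-- Theorem 3.1(iii): error bound for the conjugate DP operator. -/
theorem conjugate_dp_error_bound {d c : ℕ} (hd : 1 ≤ d)
    (X : Set (EuclideanSpace ℝ (Fin d))) (hXne : X.Nonempty) (hXcompact : IsCompact X)
    (τ : ℝ) (hτ : ∀ x ∈ X, ‖x‖ ≤ τ)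
    (XN : Finset (EuclideanSpace ℝ (Fin d))) (hXNne : XN.Nonempty)
    (hXNsub : (XN : Set (EuclideanSpace ℝ (Fin d))) ⊆ X)
    (U : Set (EuclideanSpace ℝ (Fin c))) (hUne : U.Nonempty) (hUcompact : IsCompact U)
    (η : ℝ) (hη : ∀ u ∈ U, ‖u‖ ≤ η)
    (A' : EuclideanSpace ℝ (Fin d) →L[ℝ] EuclideanSpace ℝ (Fin d))
    (B' : EuclideanSpace ℝ (Fin c) →L[ℝ] EuclideanSpace ℝ (Fin d))
    (gu : EuclideanSpace ℝ (Fin c) → ℝ) (hguc : Continuous gu)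
    (gx : EuclideanSpace ℝ (Fin d) → ℝ) (hgxc : Continuous gx)
    (J : EuclideanSpace ℝ (Fin d) → ℝ) (LJ : ℝ)
    (hJLip : ∀ x ∈ X, ∀ y ∈ X, |J x - J y| ≤ LJ * ‖x - y‖)
    (hfeas : ∀ u ∈ U, (fun xt => A' xt + B' u) '' X = X)
    (Stil : Set (EuclideanSpace ℝ (Fin d))) (hStilne : Stil.Nonempty)
    (hStilcompact : IsCompact Stil)
    (hStilb : ∀ s ∈ Stil, ‖s‖ ≤ Real.sqrt d * LJ)
    (SK : Finset (EuclideanSpace ℝ (Fin d))) (hSKne : SK.Nonempty)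
    (hSKsub : (SK : Set (EuclideanSpace ℝ (Fin d))) ⊆ Stil)
    -- discrete LFT of `J` over `XN`
    (Jstar : EuclideanSpace ℝ (Fin d) → ℝ)
    (hJstar : ∀ s, Jstar s = XN.sup' hXNne fun y => ⟪s, y⟫ - J y)
    -- (continuous) LFT of `g_u` over `U`
    (gustar : EuclideanSpace ℝ (Fin c) → ℝ)
    (hgustar : ∀ s', gustar s' = sSup ((fun u => ⟪s', u⟫ - gu u) '' U))
    (hfun : EuclideanSpace ℝ (Fin d) → ℝ)
    (hhfun : ∀ s, hfun s = gustar (-(ContinuousLinearMap.adjoint B') s) + Jstar s)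
    (DPconj : EuclideanSpace ℝ (Fin d) → ℝ)
    (hDPconj : ∀ x, DPconj x = gx x + SK.sup' hSKne fun s => ⟪A' x, s⟫ - hfun s)
    (DPshift : EuclideanSpace ℝ (Fin d) → ℝ)
    (hDPshift : ∀ xt, DPshift xt = sInf ((fun u => gu u + J (A' xt + B' u)) '' U))
    -- biconjugate of `DPshift` over the dual space `S = A'ᵀ '' S̃`
    (DPshiftbc : EuclideanSpace ℝ (Fin d) → ℝ)
    (hDPshiftbc : ∀ x, DPshiftbc x =
      sSup ((fun σ => ⟪x, σ⟫ - sSup ((fun xt => ⟪σ, xt⟫ - DPshift xt) '' X)) ''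
        ((fun s => (ContinuousLinearMap.adjoint A') s) '' Stil))) :
    ∀ x ∈ XN,
      |DPconj x - DPshiftbc x - gx x| ≤
        (1 + Real.sqrt d) * LJ * dH X (XN : Set (EuclideanSpace ℝ (Fin d)))
          + (‖A'‖ * τ + τ + ‖B'‖ * η) * dH Stil (SK : Set (EuclideanSpace ℝ (Fin d))) := by
  intro x hx
  have hxX : x ∈ X := hXNsub hx
  have hLJ : 0 ≤ LJ := by
    obtain ⟨s, hs⟩ := hStilne
    exact nonneg_of_mul_nonneg_right ((norm_nonneg s).trans (hStilb s hs))
      (Real.sqrt_pos.2 (by exact_mod_cast hd))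
  have hτ0 : 0 ≤ τ := (norm_nonneg x).trans (hτ x hxX)
  have hη0 : 0 ≤ η := hUne.elim fun u hu => (norm_nonneg u).trans (hη u hu)
  have hJc : ContinuousOn J X :=
    (LipschitzOnWith.of_dist_le_mul (K := ⟨LJ, hLJ⟩) fun a ha b hb => by
      rw [Real.dist_eq, dist_eq_norm]
      exact hJLip a ha b hb).continuousOn
  set JX : EuclideanSpace ℝ (Fin d) → ℝ := fun s => sSup ((fun y => ⟪s, y⟫ - J y) '' X) with hJX
  set F : EuclideanSpace ℝ (Fin d) → ℝ := fun s =>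
    ⟪A' x, s⟫ - (gustar (-(ContinuousLinearMap.adjoint B') s) + JX s) with hF
  have hbc : DPshiftbc x = sSup (F '' Stil) := by
    rw [hDPshiftbc, Set.image_image]
    congr 1
    refine Set.image_congr fun s _ => ?_
    simp only [hDPshift, hF, hJX, hgustar]
    rw [sSup_inner_adjoint_sub_sInf hXne hXcompact hUne hUcompact A' B' hguc.continuousOn hJc
      hfeas, ContinuousLinearMap.adjoint_inner_right]
  set DX := dH X (XN : Set (EuclideanSpace ℝ (Fin d)))
  set DS := dH Stil (SK : Set (EuclideanSpace ℝ (Fin d)))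
  have hDX : 0 ≤ DX := dH_nonneg _ _
  have hDS : 0 ≤ DS := dH_nonneg _ _
  have hE1 : 0 ≤ (1 + Real.sqrt d) * LJ * DX := by positivity
  have hE2 : 0 ≤ (‖A'‖ * τ + τ + ‖B'‖ * η) * DS := by positivity
  have hJle : ∀ s, Jstar s ≤ JX s := fun s => by
    rw [hJstar]
    exact Finset.sup'_le _ _ fun y hy =>
      le_csSup (bddAbove_inner_sub_image hXcompact hJc s) (Set.mem_image_of_mem _ (hXNsub hy))
  have hJge : ∀ s ∈ Stil, JX s ≤ Jstar s + (1 + Real.sqrt d) * LJ * DX := fun s hs => by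
    rw [hJstar]
    refine (sSup_inner_sub_le_sup'_add hXne hXcompact hXNne hXNsub hLJ hJLip s).trans ?_
    gcongr
    linarith [hStilb s hs]
  have hFbound : ∀ s ∈ Stil,
      F s ≤ (SK.sup' hSKne fun s => ⟪A' x, s⟫ - hfun s) +
        (‖A'‖ * τ + τ + ‖B'‖ * η) * DS := fun s hs => by
    obtain ⟨t, ht, hst⟩ := exists_dist_le_dH hStilcompact hSKne hs
    rw [dist_eq_norm] at hst
    have h1 : ⟪A' x, t⟫ - hfun t ≤ SK.sup' hSKne fun s => ⟪A' x, s⟫ - hfun s :=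
      Finset.le_sup' (fun s => ⟪A' x, s⟫ - hfun s) ht
    have h2 : JX t ≤ JX s + τ * ‖t - s‖ :=
      sSup_inner_sub_le_add hXne hτ t s (bddAbove_inner_sub_image hXcompact hJc s)
    have h3 := sSup_inner_sub_le_add hUne hη (-(ContinuousLinearMap.adjoint B') t)
      (-(ContinuousLinearMap.adjoint B') s)
      (bddAbove_inner_sub_image hUcompact hguc.continuousOn _)
    rw [← hgustar, ← hgustar] at h3
    have h4 : ‖-(ContinuousLinearMap.adjoint B') t - -(ContinuousLinearMap.adjoint B') s‖ ≤
        ‖B'‖ * ‖s - t‖ := by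
      rw [neg_sub_neg, ← map_sub, ← LinearIsometryEquiv.norm_map ContinuousLinearMap.adjoint B']
      exact ContinuousLinearMap.le_opNorm _ _
    have h5 : ⟪A' x, s⟫ - ⟪A' x, t⟫ ≤ ‖A'‖ * τ * ‖s - t‖ := by
      rw [← inner_sub_right]
      refine (real_inner_le_norm _ _).trans ?_
      gcongr
      exact A'.le_opNorm_of_le (hτ x hxX)
    have h6 := mul_le_mul_of_nonneg_left h4 hη0
    have h7 : (‖A'‖ * τ + τ + ‖B'‖ * η) * ‖s - t‖ ≤ (‖A'‖ * τ + τ + ‖B'‖ * η) * DS := by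
      gcongr
    have h8 := hJle t
    rw [hhfun] at h1
    rw [norm_sub_rev t s] at h2
    simp only [hF]
    linarith
  have hFbdd : BddAbove (F '' Stil) := ⟨_, Set.forall_mem_image.2 hFbound⟩
  have hupper : (SK.sup' hSKne fun s => ⟪A' x, s⟫ - hfun s) ≤
      sSup (F '' Stil) + (1 + Real.sqrt d) * LJ * DX :=
    Finset.sup'_le _ _ fun s hs => by
      have h1 := le_csSup hFbdd (Set.mem_image_of_mem F (hSKsub hs))
      have h2 := hJge s (hSKsub hs)
      rw [hhfun]
      simp only [hF] at h1 ⊢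
      linarith
  have hlower := csSup_le (hStilne.image F) (Set.forall_mem_image.2 hFbound)
  rw [hDPconj, hbc, abs_le]
  constructor <;> linarith
end

section
/- Approximation of the optimal policy (Lemma 3.2): Let U ⊆ ℝ^c be nonempty, compact and convex, g_u : ℝ^c → ℝ be continuous and μ-strongly convex on U with μ > 0, J : ℝ^d → ℝ any function, A′ : ℝ^d → ℝ^d and B′ : ℝ^c → ℝ^d linear maps, x ∈ ℝ^d, s* ∈ ℝ^d, c* ∈ ℝ and ε ≥ 0. Define φ(u) := g_u(u) + J(A′x + B′u) and ψ(u) := g_u(u) + ⟪A′x + B′u, s*⟫ − c* for u ∈ U, and assume: (a) min_{u∈U} φ(u) ≤ min_{u∈U} ψ(u) + ε, and (b) φ(u) ≥ ψ(u) − ε for all u ∈ U. Let u* be a minimizer of φ over U and û a minimizer of ψ over U (equivalently, a minimizer of u ↦ g_u(u) + ⟪B′u, s*⟫ over U). Then ‖u* − û‖ ≤ √(4ε/μ). -/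
open scoped RealInnerProductSpace

/-- A strongly convex function grows quadratically away from a minimizer. -/
theorem StrongConvexOn.add_sq_norm_sub_le_of_isMinOn {E : Type*} [NormedAddCommGroup E]
    [NormedSpace ℝ E] {s : Set E} {m : ℝ} {f : E → ℝ} (hf : StrongConvexOn s m f) {x y : E}
    (hx : x ∈ s) (hy : y ∈ s) (hmin : IsMinOn f s x) : f x + m / 2 * ‖y - x‖ ^ 2 ≤ f y := by
  have hgrowth : ∀ t : ℝ, 0 < t → t ≤ 1 → (1 - t) * (m / 2 * ‖y - x‖ ^ 2) ≤ f y - f x := by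
    intro t ht ht1
    have hconv := hf.2 hy hx ht.le (sub_nonneg.2 ht1) (add_sub_cancel t 1)
    have hle : f x ≤ f (t • y + (1 - t) • x) :=
      hmin (hf.1 hy hx ht.le (sub_nonneg.2 ht1) (add_sub_cancel t 1))
    simp only [smul_eq_mul] at hconv
    refine le_of_mul_le_mul_left ?_ ht
    linarith
  have hlim : Filter.Tendsto (fun t : ℝ => (1 - t) * (m / 2 * ‖y - x‖ ^ 2))
      (nhdsWithin 0 (Set.Ioi 0)) (nhds (m / 2 * ‖y - x‖ ^ 2)) := by
    have hcont : Continuous fun t : ℝ => (1 - t) * (m / 2 * ‖y - x‖ ^ 2) := by fun_prop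
    simpa using (hcont.tendsto 0).mono_left nhdsWithin_le_nhds
  have hle := le_of_tendsto hlim (by
    filter_upwards [Ioc_mem_nhdsGT (zero_lt_one' ℝ)] with t ht
    exact hgrowth t ht.1 ht.2)
  linarith

/-- Lemma 3.2: approximation of the optimal policy. -/
theorem optimal_policy_approximation {d c : ℕ}
    (U : Set (EuclideanSpace ℝ (Fin c))) (hUne : U.Nonempty)
    (hUcompact : IsCompact U) (hUconvex : Convex ℝ U)
    (gu : EuclideanSpace ℝ (Fin c) → ℝ) (hguc : Continuous gu)
    (μ : ℝ) (hμ : 0 < μ)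
    (hgusc : StrongConvexOn U μ gu)
    (J : EuclideanSpace ℝ (Fin d) → ℝ)
    (A' : EuclideanSpace ℝ (Fin d) →L[ℝ] EuclideanSpace ℝ (Fin d))
    (B' : EuclideanSpace ℝ (Fin c) →L[ℝ] EuclideanSpace ℝ (Fin d))
    (x sstar : EuclideanSpace ℝ (Fin d)) (cstar ε : ℝ) (hε : 0 ≤ ε)
    (φ ψ : EuclideanSpace ℝ (Fin c) → ℝ)
    (hφ : ∀ u, φ u = gu u + J (A' x + B' u))
    (hψ : ∀ u, ψ u = gu u + ⟪A' x + B' u, sstar⟫ - cstar)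
    (ha : sInf (φ '' U) ≤ sInf (ψ '' U) + ε)
    (hb : ∀ u ∈ U, ψ u - ε ≤ φ u)
    (ustar uhat : EuclideanSpace ℝ (Fin c))
    (hustarU : ustar ∈ U) (huhatU : uhat ∈ U)
    (hustarmin : ∀ u ∈ U, φ ustar ≤ φ u)
    (huhatmin : ∀ u ∈ U, ψ uhat ≤ ψ u) :
    ‖ustar - uhat‖ ≤ Real.sqrt (4 * ε / μ) := by
  have hψsc : StrongConvexOn U μ ψ := by
    refine ⟨hUconvex, fun u hu v hv a b ha hb hab => ?_⟩
    have hconv := hgusc.2 hu hv ha hb hab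
    have hb' : b = 1 - a := by linarith
    simp only [hψ, map_add, map_smul, inner_add_left, real_inner_smul_left, smul_eq_mul]
      at hconv ⊢
    subst hb'
    linarith
  have hφmin : sInf (φ '' U) = φ ustar :=
    IsLeast.csInf_eq ⟨⟨ustar, hustarU, rfl⟩, Set.forall_mem_image.2 hustarmin⟩
  have hψmin : sInf (ψ '' U) = ψ uhat :=
    IsLeast.csInf_eq ⟨⟨uhat, huhatU, rfl⟩, Set.forall_mem_image.2 huhatmin⟩
  have hgrowth := hψsc.add_sq_norm_sub_le_of_isMinOn huhatU hustarU huhatmin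
  have hstar := hb ustar hustarU
  rw [hφmin, hψmin] at ha
  apply Real.le_sqrt_of_sq_le
  rw [le_div_iff₀ hμ]
  linarith
end

section
/- Error bound for the stochastic conjugate DP operator over post-decision states (Corollary 3.8(iii)): Let d ≥ 1, X ⊆ ℝ^d nonempty compact with ‖x‖ ≤ τ for all x ∈ X, X_N ⊆ X finite nonempty, U ⊆ ℝ^c nonempty compact with ‖u‖ ≤ η for all u ∈ U, A′ : ℝ^d → ℝ^d and B′ : ℝ^c → ℝ^d linear, g_u : ℝ^c → ℝ and g_x : ℝ^d → ℝ continuous, and V : ℝ^d → ℝ be L_V-Lipschitz on X. Assume that for every u ∈ U the image {A′x̃ + B′u : x̃ ∈ X} equals X. Let S̃ ⊆ ℝ^d be nonempty compact with ‖s‖ ≤ √d·L_V for all s ∈ S̃ and S̄_K ⊆ S̃ finite nonempty. Let V^* be the discrete LFT of V over X_N, g_u⋆ the LFT of g_u over U, h(s) := g_u⋆(−B′ᵀ s) + V^*(s), and DP_shift[V](x̃) := min_{u∈U}(g_u(u) + V(A′x̃ + B′u)). Assume additionally that DP_shift[V] equals its biconjugate on X_N: sup_{σ ∈ {A′ᵀ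 s : s ∈ S̃}}(⟪x, σ⟫ − sup_{x̃∈X}(⟪σ, x̃⟫ − DP_shift[V](x̃))) = DP_shift[V](x) for all x ∈ X_N. Let r ∈ ℕ, p_0,…,p_{r−1} ≥ 0 with Σ_k p_k = 1, ξ_0,…,ξ_{r−1} ∈ ℝ^d, and let m ∈ ℝ^d satisfy m + ξ_k ∈ X_N for every k < r. Then |Σ_{k<r} p_k·(max_{s∈S̄_K}(⟪A′(m+ξ_k), s⟫ − h(s)) + g_x(m+ξ_k)) − Σ_{k<r} p_k·DP_shift[V](m+ξ_k) − Σ_{k<r} p_k·g_x(m+ξ_k)| ≤ E₁ + E₂, where E₁ := (1+√d)·L_V·d_H(X, X_N) and E₂ := (‖A′‖·τ + τ + ‖B′‖·η)·d_H(S̃, S̄_K). -/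
open scoped RealInnerProductSpace

lemma exists_mem_norm_sub_le_dH {E : Type*} [NormedAddCommGroup E]
    {X : Set E} (hX : IsCompact X) {Y : Finset E}
    (hY : Y.Nonempty) {x : E} (hx : x ∈ X) :
    ∃ y ∈ Y, ‖x - y‖ ≤ dH X (Y : Set E) := by
  obtain ⟨y, hy, hxy⟩ := Y.finite_toSet.isCompact.exists_infDist_eq_dist
    (Finset.coe_nonempty.2 hY) x
  refine ⟨y, hy, ?_⟩
  rw [← dist_eq_norm, ← hxy]
  exact le_csSup (hX.bddAbove_image (Metric.continuous_infDist_pt _).continuousOn)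
    (Set.mem_image_of_mem _ hx)

section ConjugateDP

variable {E F : Type*} [NormedAddCommGroup E] [InnerProductSpace ℝ E]
  [NormedAddCommGroup F] [InnerProductSpace ℝ F]

lemma le_legendre {U : Set F} (hU : IsCompact U) {g : F → ℝ} (hg : Continuous g) (a : F)
    {u : F} (hu : u ∈ U) :
    ⟪a, u⟫ - g u ≤ sSup ((fun u => ⟪a, u⟫ - g u) '' U) :=
  le_csSup (hU.bddAbove_image (by fun_prop)) (Set.mem_image_of_mem _ hu)

lemma legendre_le_add {U : Set F} (hU : IsCompact U) (hUne : U.Nonempty) {η : ℝ}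
    (hη : ∀ u ∈ U, ‖u‖ ≤ η) {g : F → ℝ} (hg : Continuous g) (a b : F) :
    sSup ((fun u => ⟪a, u⟫ - g u) '' U) ≤
      sSup ((fun u => ⟪b, u⟫ - g u) '' U) + ‖a - b‖ * η := by
  refine csSup_le (hUne.image _) ?_
  rintro _ ⟨u, hu, rfl⟩
  have h1 := le_legendre hU hg b hu
  have h2 := real_inner_le_norm (a - b) u
  have h3 := mul_le_mul_of_nonneg_left (hη u hu) (norm_nonneg (a - b))
  rw [inner_sub_left] at h2
  dsimp only
  linarith

lemma discrete_legendre_le_add {Y : Finset E} (hY : Y.Nonempty) {τ : ℝ}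
    (hτ : ∀ y ∈ Y, ‖y‖ ≤ τ) (V : E → ℝ) (a b : E) :
    (Y.sup' hY fun y => ⟪a, y⟫ - V y) ≤ (Y.sup' hY fun y => ⟪b, y⟫ - V y) + ‖a - b‖ * τ := by
  refine Finset.sup'_le _ _ fun y hy => ?_
  have h1 := Finset.le_sup' (fun y => ⟪b, y⟫ - V y) hy
  have h2 := real_inner_le_norm (a - b) y
  have h3 := mul_le_mul_of_nonneg_left (hτ y hy) (norm_nonneg (a - b))
  rw [inner_sub_left] at h2
  linarith

/-- Restricting the Legendre transform of a Lipschitz function to a grid costs at most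
`(‖s‖ + L) d_H`. -/
lemma inner_sub_le_discrete_legendre_add {X : Set E} (hX : IsCompact X) {Y : Finset E}
    (hY : Y.Nonempty) (hYX : (Y : Set E) ⊆ X) {V : E → ℝ} {L : ℝ} (hL : 0 ≤ L)
    (hV : ∀ x ∈ X, ∀ y ∈ X, |V x - V y| ≤ L * ‖x - y‖) (s : E) {z : E} (hz : z ∈ X) :
    ⟪s, z⟫ - V z ≤
      (Y.sup' hY fun y => ⟪s, y⟫ - V y) + (‖s‖ + L) * dH X (Y : Set E) := by
  obtain ⟨y, hy, hzy⟩ := exists_mem_norm_sub_le_dH hX hY hz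
  have h1 := Finset.le_sup' (fun y => ⟪s, y⟫ - V y) hy
  have h2 := real_inner_le_norm s (z - y)
  have h3 := (abs_le.1 (hV z hz y (hYX hy))).1
  have h4 := mul_le_mul_of_nonneg_left hzy (add_nonneg (norm_nonneg s) hL)
  rw [inner_sub_right] at h2
  linarith

variable [CompleteSpace E] [CompleteSpace F]

/-- The conjugate DP operator, without the stage cost, differs from the shifted DP operator by
at most the sum of the primal and the dual discretization errors. -/
lemma abs_conjugate_dp_sub_le
    {X : Set E} (hX : IsCompact X) {τ : ℝ} (hτ : ∀ x ∈ X, ‖x‖ ≤ τ)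
    {Y : Finset E} (hY : Y.Nonempty) (hYX : (Y : Set E) ⊆ X)
    {U : Set F} (hUne : U.Nonempty) (hU : IsCompact U) {η : ℝ} (hη : ∀ u ∈ U, ‖u‖ ≤ η)
    (A : E →L[ℝ] E) (B : F →L[ℝ] E) {g : F → ℝ} (hg : Continuous g)
    {V : E → ℝ} {L : ℝ} (hL : 0 ≤ L) (hV : ∀ x ∈ X, ∀ y ∈ X, |V x - V y| ≤ L * ‖x - y‖)
    (hfeas : ∀ u ∈ U, (fun x => A x + B u) '' X = X)
    {S : Set E} (hSne : S.Nonempty) (hS : IsCompact S) {M : ℝ} (hSM : ∀ s ∈ S, ‖s‖ ≤ M)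
    {K : Finset E} (hK : K.Nonempty) (hKS : (K : Set E) ⊆ S)
    {h : E → ℝ} (hh : ∀ s, h s =
      sSup ((fun u => ⟪-(ContinuousLinearMap.adjoint B) s, u⟫ - g u) '' U) +
        Y.sup' hY fun y => ⟪s, y⟫ - V y)
    {D : E → ℝ} (hD : ∀ x, D x = sInf ((fun u => g u + V (A x + B u)) '' U))
    {x : E} (hx : x ∈ X)
    (hexact : sSup ((fun σ => ⟪x, σ⟫ - sSup ((fun y => ⟪σ, y⟫ - D y) '' X)) ''
      ((fun s => (ContinuousLinearMap.adjoint A) s) '' S)) = D x) :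
    |(K.sup' hK fun s => ⟪A x, s⟫ - h s) - D x| ≤
      (M + L) * dH X (Y : Set E) + (‖A‖ * τ + τ + ‖B‖ * η) * dH S (K : Set E) := by
  have hXne : X.Nonempty := ⟨x, hx⟩
  have hτ0 : 0 ≤ τ := (norm_nonneg x).trans (hτ x hx)
  have hη0 : 0 ≤ η := (norm_nonneg _).trans (hη _ hUne.some_mem)
  have hM0 : 0 ≤ M := (norm_nonneg _).trans (hSM _ hSne.some_mem)
  have hdX := dH_nonneg X (Y : Set E)
  have hdS := dH_nonneg S (K : Set E)
  have hmem {y : E} (hy : y ∈ X) {u : F} (hu : u ∈ U) : A y + B u ∈ X :=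
    hfeas u hu ▸ Set.mem_image_of_mem (fun x => A x + B u) hy
  have hVbdd : ∃ C, ∀ z ∈ X, C ≤ V z := by
    refine ⟨V x - L * (τ + τ), fun z hz => ?_⟩
    have h1 := (abs_le.1 (hV z hz x hx)).1
    have h2 : ‖z - x‖ ≤ τ + τ := (norm_sub_le _ _).trans (add_le_add (hτ z hz) (hτ x hx))
    nlinarith
  have hDle {y : E} (hy : y ∈ X) {u : F} (hu : u ∈ U) : D y ≤ g u + V (A y + B u) := by
    obtain ⟨C, hC⟩ := hVbdd
    obtain ⟨G, hG⟩ := hU.bddBelow_image hg.continuousOn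
    rw [hD]
    refine csInf_le ⟨G + C, ?_⟩ (Set.mem_image_of_mem _ hu)
    rintro _ ⟨v, hv, rfl⟩
    exact add_le_add (hG (Set.mem_image_of_mem _ hv)) (hC _ (hmem hy hv))
  have hinner (s y : E) (u : F) : ⟪s, A y + B u⟫ =
      ⟪(ContinuousLinearMap.adjoint A) s, y⟫ - ⟪-(ContinuousLinearMap.adjoint B) s, u⟫ := by
    rw [inner_add_right, inner_neg_left, ContinuousLinearMap.adjoint_inner_left,
      ContinuousLinearMap.adjoint_inner_left]
    ring
  have hconj_le {s : E} (hs : s ∈ S) {y : E} (hy : y ∈ X) :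
      ⟪(ContinuousLinearMap.adjoint A) s, y⟫ - D y ≤ h s + (M + L) * dH X (Y : Set E) := by
    suffices ⟪(ContinuousLinearMap.adjoint A) s, y⟫ - (h s + (M + L) * dH X (Y : Set E)) ≤ D y by
      linarith
    rw [hD]
    refine le_csInf (hUne.image _) ?_
    rintro _ ⟨u, hu, rfl⟩
    have h1 := le_legendre hU hg (-(ContinuousLinearMap.adjoint B) s) hu
    have h2 := inner_sub_le_discrete_legendre_add hX hY hYX hL hV s (hmem hy hu)
    have h3 := mul_le_mul_of_nonneg_right (add_le_add_left (hSM s hs) L) hdX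
    have h4 := hinner s y u
    rw [hh]
    dsimp only
    linarith
  set H : E → ℝ := fun σ => sSup ((fun y => ⟪σ, y⟫ - D y) '' X)
  have hH_le {s : E} (hs : s ∈ S) :
      H ((ContinuousLinearMap.adjoint A) s) ≤ h s + (M + L) * dH X (Y : Set E) := by
    refine csSup_le (hXne.image _) ?_
    rintro _ ⟨y, hy, rfl⟩
    exact hconj_le hs hy
  have hle_H {s : E} (hs : s ∈ S) : h s ≤ H ((ContinuousLinearMap.adjoint A) s) := by
    have key : ∀ u ∈ U, ∀ y ∈ Y,
        (⟪-(ContinuousLinearMap.adjoint B) s, u⟫ - g u) + (⟪s, y⟫ - V y) ≤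
          H ((ContinuousLinearMap.adjoint A) s) := by
      intro u hu y hy
      obtain ⟨w, hw, rfl⟩ : y ∈ (fun x => A x + B u) '' X := (hfeas u hu).symm ▸ hYX hy
      have h1 : ⟪(ContinuousLinearMap.adjoint A) s, w⟫ - D w ≤
          H ((ContinuousLinearMap.adjoint A) s) := by
        refine le_csSup ⟨h s + (M + L) * dH X (Y : Set E), ?_⟩
          (Set.mem_image_of_mem (fun y => ⟪(ContinuousLinearMap.adjoint A) s, y⟫ - D y) hw)
        rintro _ ⟨v, hv, rfl⟩
        exact hconj_le hs hv
      have h2 := hDle hw hu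
      have h3 := hinner s w u
      dsimp only
      linarith
    rw [hh]
    obtain ⟨y, hy, hymax⟩ := Finset.exists_mem_eq_sup' hY fun y => ⟪s, y⟫ - V y
    rw [hymax, ← le_sub_iff_add_le]
    refine csSup_le (hUne.image _) ?_
    rintro _ ⟨u, hu, rfl⟩
    exact le_sub_iff_add_le.2 (key u hu y hy)
  have hdual {s : E} (hs : s ∈ S) : ⟪A x, s⟫ - h s ≤
      (K.sup' hK fun s => ⟪A x, s⟫ - h s) + (‖A‖ * τ + τ + ‖B‖ * η) * dH S (K : Set E) := by
    obtain ⟨t, ht, hst⟩ := exists_mem_norm_sub_le_dH hS hK hs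
    have h1 := Finset.le_sup' (fun s => ⟪A x, s⟫ - h s) ht
    have h2 : ⟪A x, s⟫ - ⟪A x, t⟫ ≤ ‖A‖ * τ * ‖s - t‖ := by
      rw [← inner_sub_right]
      exact (real_inner_le_norm _ _).trans (mul_le_mul_of_nonneg_right
        (A.le_opNorm_of_le (hτ x hx)) (norm_nonneg _))
    have h3 := legendre_le_add hU hUne hη hg (-(ContinuousLinearMap.adjoint B) t)
      (-(ContinuousLinearMap.adjoint B) s)
    have h4 := discrete_legendre_le_add hY (fun y hy => hτ y (hYX hy)) V t s
    have h5 : ‖-(ContinuousLinearMap.adjoint B) t - -(ContinuousLinearMap.adjoint B) s‖ ≤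
        ‖B‖ * ‖s - t‖ := by
      rw [neg_sub_neg, ← map_sub, ← LinearIsometryEquiv.norm_map ContinuousLinearMap.adjoint B]
      exact ContinuousLinearMap.le_opNorm _ _
    have h6 := mul_le_mul_of_nonneg_right h5 hη0
    have h7 := mul_le_mul_of_nonneg_left hst
      (show 0 ≤ ‖A‖ * τ + τ + ‖B‖ * η by positivity)
    have h8 := hh s
    have h9 := hh t
    rw [norm_sub_rev t s] at h4
    linarith
  have hadj (s : E) : ⟪x, (ContinuousLinearMap.adjoint A) s⟫ = ⟪A x, s⟫ :=
    ContinuousLinearMap.adjoint_inner_right A x s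
  have hvalue_le : ∀ v ∈ (fun σ => ⟪x, σ⟫ - H σ) ''
      ((fun s => (ContinuousLinearMap.adjoint A) s) '' S),
      v ≤ (K.sup' hK fun s => ⟪A x, s⟫ - h s) +
        (‖A‖ * τ + τ + ‖B‖ * η) * dH S (K : Set E) := by
    rintro _ ⟨_, ⟨s, hs, rfl⟩, rfl⟩
    have h1 := hdual hs
    have h2 := hle_H hs
    have h3 := hadj s
    dsimp only
    linarith
  have hE1 : 0 ≤ (M + L) * dH X (Y : Set E) := by positivity
  have hE2 : 0 ≤ (‖A‖ * τ + τ + ‖B‖ * η) * dH S (K : Set E) := by positivity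
  rw [abs_le]
  constructor
  · have h1 := csSup_le ((hSne.image _).image _) hvalue_le
    linarith
  · obtain ⟨s, hs, hmax⟩ := Finset.exists_mem_eq_sup' hK fun s => ⟪A x, s⟫ - h s
    have h1 := le_csSup ⟨_, hvalue_le⟩
      (Set.mem_image_of_mem (fun σ => ⟪x, σ⟫ - H σ) (Set.mem_image_of_mem _ (hKS hs)))
    have h2 := hH_le (hKS hs)
    have h3 := hadj s
    linarith

end ConjugateDP

/-- A convex combination of numbers bounded by `C` in absolute value is bounded by `C`. -/
lemma abs_sum_mul_le_of_sum_eq_one {ι : Type*} [Fintype ι] {p a : ι → ℝ} {C : ℝ}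
    (hp : ∀ i, 0 ≤ p i) (hp1 : ∑ i, p i = 1) (ha : ∀ i, |a i| ≤ C) :
    |∑ i, p i * a i| ≤ C :=
  calc |∑ i, p i * a i| ≤ ∑ i, |p i * a i| := Finset.abs_sum_le_sum_abs _ _
    _ ≤ ∑ i, p i * C := Finset.sum_le_sum fun i _ => by
        rw [abs_mul, abs_of_nonneg (hp i)]
        exact mul_le_mul_of_nonneg_left (ha i) (hp i)
    _ = C := by rw [← Finset.sum_mul, hp1, one_mul]

/-- Corollary 3.8(iii): error bound for the stochastic conjugate DP operator
over post-decision states. -/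
theorem stochastic_conjugate_dp_error_bound {d c : ℕ} (hd : 1 ≤ d)
    (X : Set (EuclideanSpace ℝ (Fin d))) (hXne : X.Nonempty) (hXcompact : IsCompact X)
    (τ : ℝ) (hτ : ∀ x ∈ X, ‖x‖ ≤ τ)
    (XN : Finset (EuclideanSpace ℝ (Fin d))) (hXNne : XN.Nonempty)
    (hXNsub : (XN : Set (EuclideanSpace ℝ (Fin d))) ⊆ X)
    (U : Set (EuclideanSpace ℝ (Fin c))) (hUne : U.Nonempty) (hUcompact : IsCompact U)
    (η : ℝ) (hη : ∀ u ∈ U, ‖u‖ ≤ η)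
    (A' : EuclideanSpace ℝ (Fin d) →L[ℝ] EuclideanSpace ℝ (Fin d))
    (B' : EuclideanSpace ℝ (Fin c) →L[ℝ] EuclideanSpace ℝ (Fin d))
    (gu : EuclideanSpace ℝ (Fin c) → ℝ) (hguc : Continuous gu)
    (gx : EuclideanSpace ℝ (Fin d) → ℝ) (hgxc : Continuous gx)
    (V : EuclideanSpace ℝ (Fin d) → ℝ) (LV : ℝ)
    (hVLip : ∀ x ∈ X, ∀ y ∈ X, |V x - V y| ≤ LV * ‖x - y‖)
    (hfeas : ∀ u ∈ U, (fun xt => A' xt + B' u) '' X = X)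
    (Stil : Set (EuclideanSpace ℝ (Fin d))) (hStilne : Stil.Nonempty)
    (hStilcompact : IsCompact Stil)
    (hStilb : ∀ s ∈ Stil, ‖s‖ ≤ Real.sqrt d * LV)
    (SK : Finset (EuclideanSpace ℝ (Fin d))) (hSKne : SK.Nonempty)
    (hSKsub : (SK : Set (EuclideanSpace ℝ (Fin d))) ⊆ Stil)
    -- discrete LFT of `V` over `XN`
    (Vstar : EuclideanSpace ℝ (Fin d) → ℝ)
    (hVstar : ∀ s, Vstar s = XN.sup' hXNne fun y => ⟪s, y⟫ - V y)
    -- (continuous) LFT of `g_u` over `U`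
    (gustar : EuclideanSpace ℝ (Fin c) → ℝ)
    (hgustar : ∀ s', gustar s' = sSup ((fun u => ⟪s', u⟫ - gu u) '' U))
    (hfun : EuclideanSpace ℝ (Fin d) → ℝ)
    (hhfun : ∀ s, hfun s = gustar (-(ContinuousLinearMap.adjoint B') s) + Vstar s)
    (DPshift : EuclideanSpace ℝ (Fin d) → ℝ)
    (hDPshift : ∀ xt, DPshift xt = sInf ((fun u => gu u + V (A' xt + B' u)) '' U))
    -- `DPshift` equals its biconjugate over `S = A'ᵀ '' S̃` on the grid `XN`
    (hexact : ∀ x ∈ XN,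
      sSup ((fun σ => ⟪x, σ⟫ - sSup ((fun xt => ⟪σ, xt⟫ - DPshift xt) '' X)) ''
          ((fun s => (ContinuousLinearMap.adjoint A') s) '' Stil)) = DPshift x)
    (r : ℕ) (p : Fin r → ℝ) (hp : ∀ k, 0 ≤ p k) (hpsum : ∑ k, p k = 1)
    (ξ : Fin r → EuclideanSpace ℝ (Fin d))
    (m : EuclideanSpace ℝ (Fin d)) (hm : ∀ k : Fin r, m + ξ k ∈ XN) :
    |(∑ k : Fin r,
        p k * (SK.sup' hSKne (fun s => ⟪A' (m + ξ k), s⟫ - hfun s) + gx (m + ξ k)))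
      - (∑ k : Fin r, p k * DPshift (m + ξ k))
      - (∑ k : Fin r, p k * gx (m + ξ k))| ≤
      (1 + Real.sqrt d) * LV * dH X (XN : Set (EuclideanSpace ℝ (Fin d)))
        + (‖A'‖ * τ + τ + ‖B'‖ * η) * dH Stil (SK : Set (EuclideanSpace ℝ (Fin d))) := by
  have hd0 : 0 < Real.sqrt d := Real.sqrt_pos.2 (by exact_mod_cast hd)
  have hLV : 0 ≤ LV := nonneg_of_mul_nonneg_right
    ((norm_nonneg _).trans (hStilb _ hStilne.some_mem)) hd0
  have hh (s) : hfun s =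
      sSup ((fun u => ⟪-(ContinuousLinearMap.adjoint B') s, u⟫ - gu u) '' U) +
        XN.sup' hXNne fun y => ⟪s, y⟫ - V y := by
    rw [hhfun, hgustar, hVstar]
  have hbound (k : Fin r) := abs_conjugate_dp_sub_le hXcompact hτ hXNne hXNsub hUne hUcompact hη
    A' B' hguc hLV hVLip hfeas hStilne hStilcompact hStilb hSKne hSKsub hh hDPshift
    (hXNsub (hm k)) (hexact _ (hm k))
  have hsum := abs_sum_mul_le_of_sum_eq_one hp hpsum hbound
  convert hsum using 2
  · rw [← Finset.sum_sub_distrib, ← Finset.sum_sub_distrib]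
    exact Finset.sum_congr rfl fun k _ => by ring
  · ring
end

section
/- Discretization error of the Legendre–Fenchel transform (Lemma 2.2(i)): Let d ≥ 1, let X ⊆ ℝ^d be nonempty and bounded, let X_N ⊆ X be finite and nonempty, and let f : ℝ^d → ℝ be L_f-Lipschitz on X. Then for every s ∈ ℝ^d with ‖s‖ ≤ √d · L_f, |f⋆(s) − f^*(s)| ≤ (1 + √d) · L_f · d_H(X, X_N), where f⋆ is the LFT of f over X and f^* is the discrete LFT of f over X_N. -/
open scoped RealInnerProductSpace

theorem infDist_le_dH {E : Type*} [PseudoMetricSpace E] {X Y : Set E}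
    (hX : Bornology.IsBounded X) (hYX : Y ⊆ X) (hY : Y.Nonempty) {x : E} (hx : x ∈ X) :
    Metric.infDist x Y ≤ dH X Y := by
  obtain ⟨y, hy⟩ := hY
  refine le_csSup ⟨Metric.diam X, Set.forall_mem_image.mpr fun z hz => ?_⟩
    (Set.mem_image_of_mem _ hx)
  exact (Metric.infDist_le_dist_of_mem hy).trans (Metric.dist_le_diam_of_mem hX hz (hYX hy))

/-- Lemma 2.2(i): discretization error of the Legendre–Fenchel transform. -/
theorem lft_discretization_error {d : ℕ} (hd : 1 ≤ d)
    (X : Set (EuclideanSpace ℝ (Fin d))) (hXne : X.Nonempty) (hXbdd : Bornology.IsBounded X)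
    (XN : Finset (EuclideanSpace ℝ (Fin d))) (hXNne : XN.Nonempty)
    (hXNsub : (XN : Set (EuclideanSpace ℝ (Fin d))) ⊆ X)
    (f : EuclideanSpace ℝ (Fin d) → ℝ) (Lf : ℝ)
    (hfLip : ∀ x ∈ X, ∀ y ∈ X, |f x - f y| ≤ Lf * ‖x - y‖)
    (s : EuclideanSpace ℝ (Fin d)) (hs : ‖s‖ ≤ Real.sqrt d * Lf) :
    |sSup ((fun x => ⟪s, x⟫ - f x) '' X)
        - XN.sup' hXNne (fun x => ⟪s, x⟫ - f x)| ≤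
      (1 + Real.sqrt d) * Lf * dH X (XN : Set (EuclideanSpace ℝ (Fin d))) := by
  have hLf : 0 ≤ Lf := by
    have hsqrt : 0 < Real.sqrt d := Real.sqrt_pos.mpr (by exact_mod_cast hd)
    exact nonneg_of_mul_nonneg_right ((norm_nonneg s).trans hs) hsqrt
  have hC : 0 ≤ (1 + Real.sqrt d) * Lf := by positivity
  have hupper : ∀ x ∈ X, ⟪s, x⟫ - f x ≤ XN.sup' hXNne (fun x => ⟪s, x⟫ - f x) +
      (1 + Real.sqrt d) * Lf * dH X (XN : Set (EuclideanSpace ℝ (Fin d))) := by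
    intro x hx
    obtain ⟨y, hy, hxy⟩ := XN.finite_toSet.isCompact.exists_infDist_eq_dist
      (Finset.coe_nonempty.mpr hXNne) x
    have hdist : ‖x - y‖ ≤ dH X (XN : Set (EuclideanSpace ℝ (Fin d))) := by
      rw [← dist_eq_norm, ← hxy]
      exact infDist_le_dH hXbdd hXNsub (Finset.coe_nonempty.mpr hXNne) hx
    have hf := neg_le_of_abs_le (hfLip x hx y (hXNsub hy))
    have hinner : ⟪s, x⟫ - ⟪s, y⟫ ≤ Real.sqrt d * Lf * ‖x - y‖ := by
      rw [← inner_sub_right]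
      exact (real_inner_le_norm s (x - y)).trans (by gcongr)
    have hmax := XN.le_sup' (fun x => ⟪s, x⟫ - f x) hy
    have hscaled := mul_le_mul_of_nonneg_left hdist hC
    linarith
  have hle : sSup ((fun x => ⟪s, x⟫ - f x) '' X) ≤ XN.sup' hXNne (fun x => ⟪s, x⟫ - f x) +
      (1 + Real.sqrt d) * Lf * dH X (XN : Set (EuclideanSpace ℝ (Fin d))) :=
    csSup_le (hXne.image _) (Set.forall_mem_image.mpr hupper)
  have hge : XN.sup' hXNne (fun x => ⟪s, x⟫ - f x) ≤ sSup ((fun x => ⟪s, x⟫ - f x) '' X) :=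
    Finset.sup'_le _ _ fun y hy =>
      le_csSup ⟨_, Set.forall_mem_image.mpr hupper⟩ (Set.mem_image_of_mem _ (hXNsub hy))
  rw [abs_of_nonneg (sub_nonneg.mpr hge)]
  linarith
end

section
/- Biconjugation is exact for convex extensible functions on finite sets (Lemma 2.2(iv), discrete case): Let X_N ⊆ ℝ^d be finite and nonempty and let f : ℝ^d → ℝ be convex extensible on X_N, i.e., there exists f̄ : ℝ^d → ℝ that is convex and continuous on the convex hull conv(X_N) and satisfies f̄(x) = f(x) for all x ∈ X_N. Define the discrete LFT f^*(s) := max_{x∈X_N}(⟪s,x⟫ − f(x)) and the biconjugate f^{⋆⋆}(x) := sup_{s∈ℝ^d}(⟪s,x⟫ − f^*(s)). Then f^{⋆⋆}(x) = f(x) for every x ∈ X_N. -/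
open scoped RealInnerProductSpace

/-- Lemma 2.2(iv), discrete case: biconjugation is exact for convex extensible
functions on finite sets. -/
theorem discrete_biconjugation_exact {d : ℕ}
    (XN : Finset (EuclideanSpace ℝ (Fin d))) (hXNne : XN.Nonempty)
    (f fbar : EuclideanSpace ℝ (Fin d) → ℝ)
    (hfbarconv : ConvexOn ℝ (convexHull ℝ (XN : Set (EuclideanSpace ℝ (Fin d)))) fbar)
    (hfbarc : ContinuousOn fbar (convexHull ℝ (XN : Set (EuclideanSpace ℝ (Fin d)))))
    (hagree : ∀ x ∈ XN, fbar x = f x) :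
    ∀ x ∈ XN,
      sSup (Set.range fun s : EuclideanSpace ℝ (Fin d) =>
          ⟪s, x⟫ - XN.sup' hXNne (fun y => ⟪s, y⟫ - f y))
        = f x := by
  intro x hx
  have hsub := subset_convexHull ℝ (XN : Set (EuclideanSpace ℝ (Fin d)))
  refine csSup_eq_of_forall_le_of_forall_lt_exists_gt (Set.range_nonempty _) ?_ fun w hw => ?_
  · rintro _ ⟨s, rfl⟩
    have := XN.le_sup' (fun y => ⟪s, y⟫ - f y) hx
    dsimp only at this ⊢
    linarith
  · obtain ⟨a, hwa, haf⟩ := exists_between hw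
    rw [← hagree x hx] at haf
    obtain ⟨l, c, hle, heq⟩ := hfbarconv.exists_affine_le_of_lt (𝕜 := ℝ) (hsub hx) haf
      (XN.finite_toSet.isClosed_convexHull ℝ) hfbarc.lowerSemicontinuousOn
    let s := (InnerProductSpace.toDual ℝ (EuclideanSpace ℝ (Fin d))).symm l
    have hs : ∀ y, ⟪s, y⟫ = l y := fun y => InnerProductSpace.toDual_symm_apply
    refine ⟨_, ⟨s, rfl⟩, hwa.trans_le ?_⟩
    have hsup : XN.sup' hXNne (fun y => ⟪s, y⟫ - f y) ≤ -c := by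
      refine Finset.sup'_le _ _ fun y hy => ?_
      have hy' : l y + c ≤ fbar y := hle ⟨y, hsub hy⟩
      rw [hagree y hy] at hy'
      rw [hs]
      linarith
    have heq' : l x + c = a := heq
    dsimp only
    rw [hs x]
    linarith
end
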